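/- Let φ : ℝ → ℝ and ψ : ℝ² → ℝ be smooth with φ'(x) ≠ 0 for all x and ψ_y(x,y) ≠ 0 for all (x,y). Define p̄ : ℝ³ → ℝ by p̄(x,y,p) = (ψ_x(x,y) + ψ_y(x,y)p)/φ'(x) and q̄ : ℝ⁴ → ℝ by q̄(x,y,p,q) = (p̄_x(x,y,p) + p p̄_y(x,y,p) + q p̄_p(x,y,p))/φ'(x), and define Φ : ℝ⁴ → ℝ⁴ by Φ(x,y,p,q) = (φ(x), ψ(x,y), p̄(x,y,p), q̄(x,y,p,q)). Then at every point m = (x,y,p,q), the pullbacks by Φ of the covector fields ω̄¹ = dȳ − p̄ dx̄, ω̄² = dp̄ − q̄ dx̄ and ω̄⁴ = dx̄ (evaluated in barred coordinates (x̄,ȳ,p̄,q̄)) satisfy: Φ*ω̄¹ = ψ_y(x,y)·(dy − p dx), Φ*ω̄² = p̄_p(x,y,p)·(dp − q dx) + p̄_y(x,y,p)·(dy − p dx), and Φ*ω̄⁴ = φ'(x)·dx; moreover the coefficients α = ψ_y, β = p̄_p = ψ_y/φ' and λ = φ' are everywhere nonzero. -/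

import Mathlib

/-- Partial derivative of `ψ` with respect to its first argument. -/
noncomputable def psiX (ψ : ℝ × ℝ → ℝ) (x y : ℝ) : ℝ := deriv (fun s => ψ (s, y)) x

/-- Partial derivative of `ψ` with respect to its second argument. -/
noncomputable def psiY (ψ : ℝ × ℝ → ℝ) (x y : ℝ) : ℝ := deriv (fun s => ψ (x, s)) y

/-- The prolongation `p̄ = dȳ/dx̄ = (ψ_x + ψ_y p)/φ'` of a fiber preserving
transformation `x̄ = φ(x)`, `ȳ = ψ(x,y)`. -/
noncomputable def pbar (φ : ℝ → ℝ) (ψ : ℝ × ℝ → ℝ) (x y p : ℝ) : ℝ :=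
  (psiX ψ x y + psiY ψ x y * p) / deriv φ x

/-- Partial derivative of `p̄` with respect to `x`. -/
noncomputable def pbarX (φ : ℝ → ℝ) (ψ : ℝ × ℝ → ℝ) (x y p : ℝ) : ℝ :=
  deriv (fun s => pbar φ ψ s y p) x

/-- Partial derivative of `p̄` with respect to `y`. -/
noncomputable def pbarY (φ : ℝ → ℝ) (ψ : ℝ × ℝ → ℝ) (x y p : ℝ) : ℝ :=
  deriv (fun s => pbar φ ψ x s p) y

/-- Partial derivative of `p̄` with respect to `p`. -/
noncomputable def pbarP (φ : ℝ → ℝ) (ψ : ℝ × ℝ → ℝ) (x y p : ℝ) : ℝ :=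
  deriv (fun s => pbar φ ψ x y s) p

/-- The prolongation `q̄ = dp̄/dx̄ = (p̄_x + p p̄_y + q p̄_p)/φ'`. -/
noncomputable def qbar (φ : ℝ → ℝ) (ψ : ℝ × ℝ → ℝ) (x y p q : ℝ) : ℝ :=
  (pbarX φ ψ x y p + p * pbarY φ ψ x y p + q * pbarP φ ψ x y p) / deriv φ x

/-- The prolonged fiber preserving transformation `Φ : J² → J²`,
`Φ(x,y,p,q) = (φ(x), ψ(x,y), p̄(x,y,p), q̄(x,y,p,q))`. -/
noncomputable def prolongedFP (φ : ℝ → ℝ) (ψ : ℝ × ℝ → ℝ) :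
    ℝ × ℝ × ℝ × ℝ → ℝ × ℝ × ℝ × ℝ :=
  fun m => (φ m.1, ψ (m.1, m.2.1), pbar φ ψ m.1 m.2.1 m.2.2.1,
    qbar φ ψ m.1 m.2.1 m.2.2.1 m.2.2.2)

theorem aux_psiX (ψ : ℝ × ℝ → ℝ) (hψ : Differentiable ℝ ψ) (x y : ℝ) :
    psiX ψ x y = fderiv ℝ ψ (x, y) (1, 0) := by
  have h : HasDerivAt (fun s : ℝ => (s, y)) ((1 : ℝ), (0 : ℝ)) x :=
    (hasDerivAt_id x).prodMk (hasDerivAt_const x y)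
  exact ((hψ (x, y)).hasFDerivAt.comp_hasDerivAt x h).deriv

theorem aux_psiY (ψ : ℝ × ℝ → ℝ) (hψ : Differentiable ℝ ψ) (x y : ℝ) :
    psiY ψ x y = fderiv ℝ ψ (x, y) (0, 1) := by
  have h : HasDerivAt (fun s : ℝ => (x, s)) ((0 : ℝ), (1 : ℝ)) y :=
    (hasDerivAt_const y x).prodMk (hasDerivAt_id y)
  exact ((hψ (x, y)).hasFDerivAt.comp_hasDerivAt y h).deriv

theorem aux_P (φ : ℝ → ℝ) (ψ : ℝ × ℝ → ℝ)
    (hφ : ContDiff ℝ (⊤ : ℕ∞) φ) (hψ : ContDiff ℝ (⊤ : ℕ∞) ψ)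
    (hφ' : ∀ x : ℝ, deriv φ x ≠ 0) :
    ContDiff ℝ (⊤ : ℕ∞) (fun m : ℝ × ℝ × ℝ => pbar φ ψ m.1 m.2.1 m.2.2) := by
  have hd : Differentiable ℝ ψ := hψ.differentiable (by simp)
  have h1 : ContDiff ℝ (⊤ : ℕ∞) (fderiv ℝ ψ) := hψ.fderiv_right (by simp)
  have h2 : ContDiff ℝ (⊤ : ℕ∞) (deriv φ) := (contDiff_infty_iff_deriv.1 hφ).2
  unfold pbar
  simp only [aux_psiX ψ hd, aux_psiY ψ hd]
  refine ContDiff.div ?_ (by fun_prop) (fun m => hφ' _)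
  have h3 : ContDiff ℝ (⊤ : ℕ∞) (fun m : ℝ × ℝ × ℝ => fderiv ℝ ψ (m.1, m.2.1)) :=
    h1.comp (by fun_prop)
  exact (h3.clm_apply contDiff_const).add ((h3.clm_apply contDiff_const).mul (by fun_prop))

theorem aux_partials (P : ℝ × ℝ × ℝ → ℝ) (hP : Differentiable ℝ P) (x y p : ℝ) :
    deriv (fun s => P (s, y, p)) x = fderiv ℝ P (x, y, p) (1, 0, 0) ∧
    deriv (fun s => P (x, s, p)) y = fderiv ℝ P (x, y, p) (0, 1, 0) ∧
    deriv (fun s => P (x, y, s)) p = fderiv ℝ P (x, y, p) (0, 0, 1) := by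
  refine ⟨?_, ?_, ?_⟩
  · have h : HasDerivAt (fun s : ℝ => (s, y, p)) ((1 : ℝ), (0 : ℝ), (0 : ℝ)) x :=
      (hasDerivAt_id x).prodMk ((hasDerivAt_const x y).prodMk (hasDerivAt_const x p))
    exact ((hP (x, y, p)).hasFDerivAt.comp_hasDerivAt x h).deriv
  · have h : HasDerivAt (fun s : ℝ => (x, s, p)) ((0 : ℝ), (1 : ℝ), (0 : ℝ)) y :=
      (hasDerivAt_const y x).prodMk ((hasDerivAt_id y).prodMk (hasDerivAt_const y p))
    exact ((hP (x, y, p)).hasFDerivAt.comp_hasDerivAt y h).deriv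
  · have h : HasDerivAt (fun s : ℝ => (x, y, s)) ((0 : ℝ), (0 : ℝ), (1 : ℝ)) p :=
      (hasDerivAt_const p x).prodMk ((hasDerivAt_const p y).prodMk (hasDerivAt_id p))
    exact ((hP (x, y, p)).hasFDerivAt.comp_hasDerivAt p h).deriv

theorem aux_pbarP (φ : ℝ → ℝ) (ψ : ℝ × ℝ → ℝ) (x y p : ℝ) :
    pbarP φ ψ x y p = psiY ψ x y / deriv φ x := by
  unfold pbarP pbar
  have h : HasDerivAt (fun s : ℝ => (psiX ψ x y + psiY ψ x y * s) / deriv φ x)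
      ((psiY ψ x y * 1) / deriv φ x) p :=
    (((hasDerivAt_id p).const_mul _).const_add _).div_const _
  rw [h.deriv, mul_one]

/-- The transformation law of the contact coframe `(ω¹, ω², ω⁴)` of a third order
ODE under a prolonged fiber preserving transformation:
`Φ*ω̄¹ = ψ_y ω¹`, `Φ*ω̄² = p̄_p ω² + p̄_y ω¹`, `Φ*ω̄⁴ = φ' ω⁴`, with the coefficients
`α = ψ_y`, `β = p̄_p = ψ_y/φ'` and `λ = φ'` everywhere nonzero. -/
theorem fiber_preserving_transformation_law
    (φ : ℝ → ℝ) (ψ : ℝ × ℝ → ℝ)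
    (hφ : ContDiff ℝ (⊤ : ℕ∞) φ) (hψ : ContDiff ℝ (⊤ : ℕ∞) ψ)
    (hφ' : ∀ x : ℝ, deriv φ x ≠ 0)
    (hψy : ∀ x y : ℝ, psiY ψ x y ≠ 0) :
    ∀ m v : ℝ × ℝ × ℝ × ℝ,
      -- Φ*ω̄¹ = ψ_y (dy − p dx)
      ((fderiv ℝ (prolongedFP φ ψ) m v).2.1
          - (prolongedFP φ ψ m).2.2.1 * (fderiv ℝ (prolongedFP φ ψ) m v).1
        = psiY ψ m.1 m.2.1 * (v.2.1 - m.2.2.1 * v.1)) ∧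
      -- Φ*ω̄² = p̄_p (dp − q dx) + p̄_y (dy − p dx)
      ((fderiv ℝ (prolongedFP φ ψ) m v).2.2.1
          - (prolongedFP φ ψ m).2.2.2 * (fderiv ℝ (prolongedFP φ ψ) m v).1
        = pbarP φ ψ m.1 m.2.1 m.2.2.1 * (v.2.2.1 - m.2.2.2 * v.1)
          + pbarY φ ψ m.1 m.2.1 m.2.2.1 * (v.2.1 - m.2.2.1 * v.1)) ∧
      -- Φ*ω̄⁴ = φ' dx
      ((fderiv ℝ (prolongedFP φ ψ) m v).1 = deriv φ m.1 * v.1) ∧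
      -- β = p̄_p = ψ_y / φ', and α, β, λ are nonzero
      (pbarP φ ψ m.1 m.2.1 m.2.2.1 = psiY ψ m.1 m.2.1 / deriv φ m.1) ∧
      psiY ψ m.1 m.2.1 ≠ 0 ∧
      pbarP φ ψ m.1 m.2.1 m.2.2.1 ≠ 0 ∧
      deriv φ m.1 ≠ 0 := by
  have hd : Differentiable ℝ ψ := hψ.differentiable (by simp)
  have hdφ : Differentiable ℝ φ := hφ.differentiable (by simp)
  have h2 : ContDiff ℝ (⊤ : ℕ∞) (deriv φ) := (contDiff_infty_iff_deriv.1 hφ).2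
  have hPc := aux_P φ ψ hφ hψ hφ'
  obtain ⟨P, hPdef⟩ : ∃ P : ℝ × ℝ × ℝ → ℝ,
    P = fun m : ℝ × ℝ × ℝ => pbar φ ψ m.1 m.2.1 m.2.2 := ⟨_, rfl⟩
  rw [← hPdef] at hPc
  have hPd : Differentiable ℝ P := hPc.differentiable (by simp)
  have hPf : ContDiff ℝ (⊤ : ℕ∞) (fderiv ℝ P) := hPc.fderiv_right (by simp)
  have hX : ∀ x y p, pbarX φ ψ x y p = fderiv ℝ P (x, y, p) (1, 0, 0) := fun x y p => by
    rw [← (aux_partials P hPd x y p).1, hPdef]; rfl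
  have hY : ∀ x y p, pbarY φ ψ x y p = fderiv ℝ P (x, y, p) (0, 1, 0) := fun x y p => by
    rw [← (aux_partials P hPd x y p).2.1, hPdef]; rfl
  have hZ : ∀ x y p, pbarP φ ψ x y p = fderiv ℝ P (x, y, p) (0, 0, 1) := fun x y p => by
    rw [← (aux_partials P hPd x y p).2.2, hPdef]; rfl
  have hQ : Differentiable ℝ (fun m : ℝ × ℝ × ℝ × ℝ =>
      qbar φ ψ m.1 m.2.1 m.2.2.1 m.2.2.2) := by
    unfold qbar
    simp only [hX, hY, hZ]
    have h3 : ContDiff ℝ (⊤ : ℕ∞)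
        (fun m : ℝ × ℝ × ℝ × ℝ => fderiv ℝ P (m.1, m.2.1, m.2.2.1)) :=
      hPf.comp (by fun_prop)
    refine ContDiff.differentiable (n := (⊤ : ℕ∞)) ?_ (by simp)
    refine ContDiff.div ?_ (by fun_prop) (fun m => hφ' _)
    exact ((h3.clm_apply contDiff_const).add
      (ContDiff.mul (by fun_prop) (h3.clm_apply contDiff_const))).add
      (ContDiff.mul (by fun_prop) (h3.clm_apply contDiff_const))
  rintro ⟨x, y, p, q⟩ ⟨a, b, c, d⟩
  have f1 : HasFDerivAt (fun m : ℝ × ℝ × ℝ × ℝ => φ m.1) _ (x, y, p, q) :=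
    (hdφ x).hasFDerivAt.comp (x, y, p, q) hasFDerivAt_fst
  have f2 : HasFDerivAt (fun m : ℝ × ℝ × ℝ × ℝ => ψ (m.1, m.2.1)) _ (x, y, p, q) :=
    (hd (x, y)).hasFDerivAt.comp (x, y, p, q)
      (hasFDerivAt_fst.prodMk (hasFDerivAt_fst.comp (x, y, p, q) hasFDerivAt_snd))
  have f3 : HasFDerivAt (fun m : ℝ × ℝ × ℝ × ℝ => P (m.1, m.2.1, m.2.2.1)) _ (x, y, p, q) :=
    (hPd (x, y, p)).hasFDerivAt.comp (x, y, p, q)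
      (hasFDerivAt_fst.prodMk ((hasFDerivAt_fst.comp (x, y, p, q) hasFDerivAt_snd).prodMk
        (hasFDerivAt_fst.comp (x, y, p, q) (hasFDerivAt_snd.comp (x, y, p, q) hasFDerivAt_snd))))
  have f4 := (hQ (x, y, p, q)).hasFDerivAt
  have F := f1.prodMk (f2.prodMk (f3.prodMk f4))
  have hΦ : prolongedFP φ ψ = fun m : ℝ × ℝ × ℝ × ℝ => (φ m.1, ψ (m.1, m.2.1),
      P (m.1, m.2.1, m.2.2.1), qbar φ ψ m.1 m.2.1 m.2.2.1 m.2.2.2) := by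
    rw [hPdef]; rfl
  rw [← hΦ] at F
  have e1 : (fderiv ℝ (prolongedFP φ ψ) (x, y, p, q) (a, b, c, d)).1 = deriv φ x * a := by
    rw [F.fderiv]
    change fderiv ℝ φ x a = _
    rw [fderiv_eq_smul_deriv, smul_eq_mul, mul_comm]
  have e2 : (fderiv ℝ (prolongedFP φ ψ) (x, y, p, q) (a, b, c, d)).2.1
      = psiX ψ x y * a + psiY ψ x y * b := by
    rw [F.fderiv, aux_psiX ψ hd, aux_psiY ψ hd]
    change fderiv ℝ ψ (x, y) (a, b) = _
    have : ((a, b) : ℝ × ℝ) = a • (1, 0) + b • (0, 1) := by simp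
    rw [this, map_add, map_smul, map_smul, smul_eq_mul, smul_eq_mul]; ring
  have e3 : (fderiv ℝ (prolongedFP φ ψ) (x, y, p, q) (a, b, c, d)).2.2.1
      = pbarX φ ψ x y p * a + pbarY φ ψ x y p * b + pbarP φ ψ x y p * c := by
    rw [F.fderiv, hX, hY, hZ]
    change fderiv ℝ P (x, y, p) (a, b, c) = _
    have : ((a, b, c) : ℝ × ℝ × ℝ) = a • (1, 0, 0) + b • (0, 1, 0) + c • (0, 0, 1) := by simp
    rw [this, map_add, map_add, map_smul, map_smul, map_smul, smul_eq_mul, smul_eq_mul,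
      smul_eq_mul]; ring
  have hx := hφ' x
  refine ⟨?_, ?_, e1, aux_pbarP φ ψ x y p, hψy x y, ?_, hx⟩
  · rw [e1, e2]
    simp only [prolongedFP, pbar]
    field_simp
    ring
  · rw [e1, e3]
    simp only [prolongedFP, qbar]
    field_simp
    ring
  · change pbarP φ ψ x y p ≠ 0
    rw [aux_pbarP]
    exact div_ne_zero (hψy x y) hx
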